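/- For every ε > 0 there is a constant C_ε > 0 such that for all x ∈ ℝ \ ℤ and all t ∈ ℝ, |K⁺(1/2 + it, x)| ≤ C_ε · (1 + |t|)^{1/4 + ε}, where K⁺(s,x) := F⁺(s,x) − χ(s)·({x}^{s−1} + {−x}^{s−1}). In particular, the bound is uniform in x. -/

import Mathlib

open Real Filter Complex HurwitzZeta

/-- `F⁺(s,x) = F(s,x) + F(s,-x)`, where `F(s,x)` is the analytic continuation of the
periodic zeta function `∑_{n≥1} e^{2πinx}/n^s`. -/
noncomputable def Fplus (s : ℂ) (x : ℝ) : ℂ :=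
  expZeta (↑x : UnitAddCircle) s + expZeta (↑(-x) : UnitAddCircle) s

/-- `χ(s) = 2 Γ(1-s) (2π)^{s-1} sin(πs/2)`, as in the functional equation of `ζ`. -/
noncomputable def chiFE (s : ℂ) : ℂ :=
  2 * Complex.Gamma (1 - s) * (2 * (π : ℂ)) ^ (s - 1) * Complex.sin ((π : ℂ) * s / 2)

/-- `K⁺(s,x) = F⁺(s,x) - χ(s)({x}^{s-1} + {-x}^{s-1})`. -/
noncomputable def Kplus (s : ℂ) (x : ℝ) : ℂ :=
  Fplus s x - chiFE s * ((((Int.fract x : ℝ) : ℂ)) ^ (s - 1) + (((Int.fract (-x) : ℝ) : ℂ)) ^ (s - 1))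

/-- A Gaussian centred at `T` localizes polynomial growth. -/
lemma one_add_abs_rpow_mul_exp_neg_sq_le {α : ℝ} (hα : 0 ≤ α) (t T : ℝ) :
    (1 + |t|) ^ α * Real.exp (-(t - T) ^ 2) ≤ Real.exp (α ^ 2) * (1 + |T|) ^ α := by
  have h1 : 1 + |t| ≤ (1 + |T|) * Real.exp |t - T| := by
    have h2 : |t| ≤ |T| + |t - T| := by
      simpa using abs_add_le T (t - T)
    have h3 := Real.add_one_le_exp |t - T|
    nlinarith [abs_nonneg T, abs_nonneg (t - T)]
  have h4 : (1 + |t|) ^ α ≤ (1 + |T|) ^ α * Real.exp (|t - T| * α) := by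
    rw [Real.exp_mul, ← Real.mul_rpow (by positivity) (by positivity)]
    exact Real.rpow_le_rpow (by positivity) h1 hα
  calc (1 + |t|) ^ α * Real.exp (-(t - T) ^ 2)
      ≤ (1 + |T|) ^ α * Real.exp (|t - T| * α) * Real.exp (-(t - T) ^ 2) := by gcongr
    _ = Real.exp (|t - T| * α - (t - T) ^ 2) * (1 + |T|) ^ α := by
        rw [mul_assoc, ← Real.exp_add, mul_comm, ← sub_eq_add_neg]
    _ ≤ _ := by
        gcongr
        rw [← sq_abs (t - T)]
        nlinarith [sq_nonneg (|t - T| - α), sq_nonneg (|t - T|), sq_nonneg α]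

lemma norm_exp_sub_sq (w w₀ : ℂ) :
    ‖cexp ((w - w₀) ^ 2)‖ =
      Real.exp ((w.re - w₀.re) ^ 2) * Real.exp (-(w.im - w₀.im) ^ 2) := by
  rw [Complex.norm_exp, ← Real.exp_add]
  congr 1
  simp [sq]
  ring

/-- Three lines theorem for functions of polynomial growth on the boundary of a strip and of at most
exponential growth inside, with a constant depending only on the strip and on the exponents. -/
theorem norm_le_of_polynomial_growth_on_lines {f : ℂ → ℂ} {l u α β M A B : ℝ} (hlu : l < u)
    (hα : 0 ≤ α) (hβ : 0 ≤ β) (hM : 0 ≤ M) (hB : 0 ≤ B)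
    (hd : DiffContOnCl ℂ f (HadamardThreeLines.verticalStrip l u))
    (hgrowth : ∀ w : ℂ, l ≤ w.re → w.re ≤ u → ‖f w‖ ≤ A * Real.exp (B * |w.im|))
    (hl : ∀ w : ℂ, w.re = l → ‖f w‖ ≤ M * (1 + |w.im|) ^ α)
    (hu : ∀ w : ℂ, w.re = u → ‖f w‖ ≤ M * (1 + |w.im|) ^ β)
    {w₀ : ℂ} (hl₀ : l ≤ w₀.re) (hu₀ : w₀.re ≤ u) :
    ‖f w₀‖ ≤ Real.exp ((u - l) ^ 2 + α ^ 2 + β ^ 2) * M *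
      (1 + |w₀.im|) ^ ((1 - (w₀.re - l) / (u - l)) * α + (w₀.re - l) / (u - l) * β) := by
  set g : ℂ → ℂ := fun w ↦ f w * cexp ((w - w₀) ^ 2) with hg
  set K : ℝ := Real.exp ((u - l) ^ 2 + α ^ 2 + β ^ 2) * M with hK
  have hK0 : 0 ≤ K := by positivity
  set θ := (w₀.re - l) / (u - l) with hθ
  have hexp {w : ℂ} (h1 : l ≤ w.re) (h2 : w.re ≤ u) :
      ‖cexp ((w - w₀) ^ 2)‖ ≤ Real.exp ((u - l) ^ 2) * Real.exp (-(w.im - w₀.im) ^ 2) := by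
    rw [norm_exp_sub_sq]
    gcongr ?_ * _
    apply Real.exp_le_exp.2
    rw [sq_le_sq, abs_of_pos (sub_pos.2 hlu), abs_le]
    constructor <;> linarith
  have hline {w : ℂ} {γ : ℝ} (hγ : 0 ≤ γ) (hγ' : γ ^ 2 ≤ α ^ 2 + β ^ 2) (h1 : l ≤ w.re)
      (h2 : w.re ≤ u) (hw : ‖f w‖ ≤ M * (1 + |w.im|) ^ γ) :
      ‖g w‖ ≤ K * (1 + |w₀.im|) ^ γ := by
    calc ‖g w‖ = ‖f w‖ * ‖cexp ((w - w₀) ^ 2)‖ := norm_mul _ _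
      _ ≤ (M * (1 + |w.im|) ^ γ) * (Real.exp ((u - l) ^ 2) * Real.exp (-(w.im - w₀.im) ^ 2)) := by
          gcongr
          exact hexp h1 h2
      _ = M * Real.exp ((u - l) ^ 2) *
            ((1 + |w.im|) ^ γ * Real.exp (-(w.im - w₀.im) ^ 2)) := by ring
      _ ≤ M * Real.exp ((u - l) ^ 2) * (Real.exp (γ ^ 2) * (1 + |w₀.im|) ^ γ) :=
          mul_le_mul_of_nonneg_left (one_add_abs_rpow_mul_exp_neg_sq_le hγ _ _) (by positivity)
      _ = Real.exp ((u - l) ^ 2 + γ ^ 2) * M * (1 + |w₀.im|) ^ γ := by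
          rw [Real.exp_add]; ring
      _ ≤ K * (1 + |w₀.im|) ^ γ := by
          rw [hK]
          gcongr ?_ * _ * _
          apply Real.exp_le_exp.2
          linarith
  have hbdd : BddAbove ((norm ∘ g) '' HadamardThreeLines.verticalClosedStrip l u) := by
    refine ⟨|A| * Real.exp ((u - l) ^ 2) * Real.exp (B * |w₀.im| + B ^ 2), ?_⟩
    rintro _ ⟨w, hw, rfl⟩
    obtain ⟨h1, h2⟩ : l ≤ w.re ∧ w.re ≤ u := hw
    calc ‖g w‖ = ‖f w‖ * ‖cexp ((w - w₀) ^ 2)‖ := norm_mul _ _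
      _ ≤ (|A| * Real.exp (B * |w.im|)) *
            (Real.exp ((u - l) ^ 2) * Real.exp (-(w.im - w₀.im) ^ 2)) := by
          gcongr
          · exact (hgrowth w h1 h2).trans (by gcongr; exact le_abs_self A)
          · exact hexp h1 h2
      _ = |A| * Real.exp ((u - l) ^ 2) * Real.exp (B * |w.im| - (w.im - w₀.im) ^ 2) := by
          rw [sub_eq_add_neg (B * |w.im|), Real.exp_add]; ring
      _ ≤ _ := by
          gcongr
          have h3 : |w.im| ≤ |w₀.im| + |w.im - w₀.im| := by
            simpa using abs_add_le w₀.im (w.im - w₀.im)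
          rw [← sq_abs (w.im - w₀.im)]
          nlinarith [sq_nonneg (|w.im - w₀.im| - B), sq_nonneg (|w.im - w₀.im|), sq_nonneg B]
  have hgd : DiffContOnCl ℂ g (HadamardThreeLines.verticalStrip l u) :=
    hd.smul (Differentiable.diffContOnCl (by fun_prop))
  have key := HadamardThreeLines.norm_le_interp_of_mem_verticalClosedStrip' (f := g) (z := w₀) hlu
    ⟨hl₀, hu₀⟩ hgd hbdd
    (fun w (hw : w.re = l) ↦ hline hα (by nlinarith) hw.ge (hw.le.trans hlu.le) (hl w hw))
    (fun w (hw : w.re = u) ↦ hline hβ (by nlinarith) (hlu.le.trans hw.ge) hw.le (hu w hw))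
  have hg0 : g w₀ = f w₀ := by simp [hg]
  rw [hg0] at key
  refine key.trans (le_of_eq ?_)
  have hp : 0 < 1 + |w₀.im| := by positivity
  rw [← hθ, Real.mul_rpow hK0 (by positivity), Real.mul_rpow hK0 (by positivity),
    ← Real.rpow_mul hp.le, ← Real.rpow_mul hp.le, mul_mul_mul_comm, ← Real.rpow_add hp,
    ← Real.rpow_add_of_nonneg hK0]
  · rw [sub_add_cancel, Real.rpow_one, mul_comm α, mul_comm β]
  · rw [sub_nonneg, hθ, div_le_one (by linarith)]; linarith
  · exact div_nonneg (by linarith) (by linarith)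

/-- Mellin transforms are bounded on closed vertical strips of convergence. -/
lemma exists_norm_mellin_le {f : ℝ → ℂ} {l u : ℝ} (hl : MellinConvergent f l)
    (hu : MellinConvergent f u) :
    ∃ C : ℝ, 0 ≤ C ∧ ∀ s : ℂ, l ≤ s.re → s.re ≤ u → ‖mellin f s‖ ≤ C := by
  refine ⟨∫ t in Set.Ioi (0 : ℝ), (‖(t : ℂ) ^ ((l : ℂ) - 1) • f t‖ + ‖(t : ℂ) ^ ((u : ℂ) - 1) • f t‖),
    by positivity, fun s h1 h2 ↦ ?_⟩
  refine MeasureTheory.norm_integral_le_of_norm_le (hl.norm.add hu.norm) ?_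
  refine (MeasureTheory.ae_restrict_iff' measurableSet_Ioi).2 (.of_forall fun t ht ↦ ?_)
  have ht : 0 < t := ht
  simp only [norm_smul, norm_cpow_eq_rpow_re_of_pos ht, sub_re, one_re, ofReal_re]
  rw [← add_mul]
  gcongr
  rcases le_total t 1 with h | h
  · have := Real.rpow_le_rpow_of_exponent_ge ht h (sub_le_sub_right h1 1)
    have := Real.rpow_nonneg ht.le (u - 1)
    linarith
  · have := Real.rpow_le_rpow_of_exponent_le h (sub_le_sub_right h2 1)
    have := Real.rpow_nonneg ht.le (l - 1)
    linarith

lemma exists_norm_Gamma_le {l u : ℝ} (hl : 0 < l) (hu : 0 < u) :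
    ∃ C : ℝ, 0 ≤ C ∧ ∀ s : ℂ, l ≤ s.re → s.re ≤ u → ‖Complex.Gamma s‖ ≤ C := by
  have hconv {σ : ℝ} (hσ : 0 < σ) : MellinConvergent (fun t : ℝ ↦ (Real.exp (-t) : ℂ)) σ := by
    have := Complex.GammaIntegral_convergent (s := σ) (by simpa using hσ)
    refine this.congr (.of_forall fun t ↦ ?_)
    simp [mul_comm]
  obtain ⟨C, hC, h⟩ := exists_norm_mellin_le (hconv hl) (hconv hu)
  refine ⟨C, hC, fun s h1 h2 ↦ ?_⟩
  rw [Complex.Gamma_eq_integral (hl.trans_le h1), GammaIntegral_eq_mellin]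
  exact h s h1 h2

lemma exists_norm_completedHurwitzZetaEven₀_le (a : UnitAddCircle) (l u : ℝ) :
    ∃ C : ℝ, 0 ≤ C ∧ ∀ s : ℂ, l ≤ s.re → s.re ≤ u → ‖completedHurwitzZetaEven₀ a s‖ ≤ C := by
  have hconv (s : ℂ) : MellinConvergent (hurwitzEvenFEPair a).f_modif s :=
    ((hurwitzEvenFEPair a).isStrongFEPair_toStrongFEPair.hasMellin s).1
  obtain ⟨C, hC, h⟩ := exists_norm_mellin_le (hconv (l / 2 : ℝ)) (hconv (u / 2 : ℝ))
  refine ⟨C, hC, fun s h1 h2 ↦ ?_⟩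
  rw [completedHurwitzZetaEven₀, norm_div]
  have : ‖(hurwitzEvenFEPair a).Λ₀ (s / 2)‖ ≤ C := by
    refine h (s / 2) ?_ ?_ <;> simp <;> linarith
  simp only [Complex.norm_ofNat]
  linarith

lemma norm_exp_mul_I_le (z : ℂ) : ‖cexp (z * I)‖ ≤ Real.exp |z.im| := by
  rw [Complex.norm_exp]
  apply Real.exp_le_exp.2
  simpa using neg_le_abs z.im

lemma norm_cos_le_exp_abs_im (z : ℂ) : ‖Complex.cos z‖ ≤ Real.exp |z.im| := by
  have h1 := norm_exp_mul_I_le z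
  have h2 := norm_exp_mul_I_le (-z)
  rw [neg_im, abs_neg] at h2
  rw [Complex.cos, norm_div, Complex.norm_ofNat]
  linarith [norm_add_le (cexp (z * I)) (cexp (-z * I))]

lemma norm_sin_le_exp_abs_im (z : ℂ) : ‖Complex.sin z‖ ≤ Real.exp |z.im| := by
  have h := norm_cos_le_exp_abs_im (z - π / 2)
  rw [Complex.cos_sub_pi_div_two] at h
  simpa using h

lemma inv_Gamma_eq {z : ℂ} (hz : z.re < 1) :
    (Complex.Gamma z)⁻¹ = Complex.Gamma (1 - z) * Complex.sin (π * z) / π := by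
  have h0 : Complex.Gamma (1 - z) ≠ 0 := Complex.Gamma_ne_zero_of_re_pos (by simpa using hz)
  have h := congrArg (·⁻¹) (Complex.Gamma_mul_Gamma_one_sub z)
  simp only [mul_inv, inv_div] at h
  field_simp at h ⊢
  exact h

lemma exists_norm_inv_Gammaℝ_le {l u : ℝ} (hl : l < 2) (hu : u < 2) :
    ∃ C : ℝ, 0 ≤ C ∧ ∀ s : ℂ, l ≤ s.re → s.re ≤ u →
      ‖(Gammaℝ s)⁻¹‖ ≤ C * Real.exp (2 * |s.im|) := by
  obtain ⟨C, hC, h⟩ := exists_norm_Gamma_le (l := 1 - u / 2) (u := 1 - l / 2)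
    (by linarith) (by linarith)
  refine ⟨π ^ (u / 2) * (C / π), by positivity, fun s h1 h2 ↦ ?_⟩
  have hpi : ‖((π : ℂ) ^ (-s / 2))⁻¹‖ ≤ π ^ (u / 2) := by
    rw [norm_inv, norm_cpow_eq_rpow_re_of_pos Real.pi_pos, ← Real.rpow_neg Real.pi_pos.le]
    apply Real.rpow_le_rpow_of_exponent_le (by linarith [Real.pi_gt_three])
    simp
    linarith
  rw [Gammaℝ_def, mul_inv, norm_mul, inv_Gamma_eq (by simp; linarith), mul_assoc]
  gcongr
  rw [norm_div, norm_mul, Complex.norm_real, Real.norm_of_nonneg Real.pi_pos.le, div_mul_eq_mul_div]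
  gcongr
  · refine h _ ?_ ?_ <;> simp <;> linarith
  · refine (norm_sin_le_exp_abs_im _).trans ?_
    have : (π * (s / 2) : ℂ).im = π / 2 * s.im := by simp; ring
    rw [this, abs_mul, abs_of_pos (by positivity)]
    gcongr
    linarith [Real.pi_lt_four]

/-- The factor of the functional equation relating `hurwitzZetaEven` and `cosZeta`. -/
noncomputable def evenGammaFactor (w : ℂ) : ℂ :=
  2 * (2 * π) ^ (-w) * Complex.Gamma w * Complex.cos (π * w / 2)

lemma chiFE_one_sub (w : ℂ) : chiFE (1 - w) = evenGammaFactor w := by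
  have h : (π : ℂ) * (1 - w) / 2 = π / 2 - π * w / 2 := by ring
  rw [chiFE, evenGammaFactor, h, Complex.sin_pi_div_two_sub, sub_sub_cancel,
    show (1 - w - 1 : ℂ) = -w by ring]
  ring

lemma norm_two_pi_cpow (z : ℂ) : ‖(2 * π : ℂ) ^ z‖ = (2 * π) ^ z.re := by
  have := norm_cpow_eq_rpow_re_of_pos Real.two_pi_pos z
  simpa using this

lemma one_sub_eq_conj {w : ℂ} (hw : w.re = 1 / 2) : 1 - w = (starRingEnd ℂ) w := by
  apply Complex.ext
  · simp; linarith
  · simp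

lemma norm_sin_half_eq_norm_cos_half {w : ℂ} (hw : w.re = 1 / 2) :
    ‖Complex.sin (π * w / 2)‖ = ‖Complex.cos (π * w / 2)‖ := by
  rw [← Complex.norm_conj (Complex.cos _), ← Complex.cos_conj, ← Complex.cos_pi_div_two_sub]
  congr 2
  have : (starRingEnd ℂ) (π * w / 2) = π * (starRingEnd ℂ) w / 2 := by
    rw [map_div₀, map_mul, Complex.conj_ofReal, map_ofNat]
  rw [this, ← one_sub_eq_conj hw]
  ring

lemma norm_evenGammaFactor_of_re_eq_half {w : ℂ} (hw : w.re = 1 / 2) :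
    ‖evenGammaFactor w‖ = 1 := by
  have hG := Complex.Gamma_mul_Gamma_one_sub w
  have hsin : Complex.sin (π * w) ≠ 0 := by
    intro h
    rw [h, div_zero] at hG
    exact mul_ne_zero (Complex.Gamma_ne_zero_of_re_pos (by rw [hw]; norm_num))
      (Complex.Gamma_ne_zero_of_re_pos (by simp [hw]; norm_num)) hG
  have h2 : Complex.sin (π * w) = 2 * Complex.sin (π * w / 2) * Complex.cos (π * w / 2) := by
    rw [← Complex.sin_two_mul]
    congr 1
    ring
  have hn := congrArg norm hG
  rw [one_sub_eq_conj hw, Complex.Gamma_conj, norm_mul, Complex.norm_conj, h2, norm_div, norm_mul,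
    norm_mul, norm_sin_half_eq_norm_cos_half hw, Complex.norm_real,
    Real.norm_of_nonneg Real.pi_pos.le, Complex.norm_ofNat] at hn
  have hc : ‖Complex.cos (π * w / 2)‖ ≠ 0 := by
    intro h
    rw [norm_eq_zero] at h
    exact hsin (by rw [h2, h, mul_zero])
  have hsq : ‖evenGammaFactor w‖ ^ 2 = 1 := by
    have h3 : ((2 * π : ℝ) ^ (-w).re) ^ 2 = (2 * π)⁻¹ := by
      rw [← Real.rpow_natCast, ← Real.rpow_mul (by positivity), ← Real.rpow_neg_one]
      congr 1
      simp [hw]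
    rw [evenGammaFactor, norm_mul, norm_mul, norm_mul, norm_two_pi_cpow, mul_pow, mul_pow, mul_pow,
      h3, sq ‖Complex.Gamma w‖, hn, Complex.norm_ofNat]
    field_simp
  exact (pow_eq_one_iff_of_nonneg (norm_nonneg _) two_ne_zero).1 hsq

lemma norm_evenGammaFactor_add_one {w : ℂ} (hw : w.re = 1 / 2) :
    ‖evenGammaFactor (w + 1)‖ = ‖w‖ / (2 * π) := by
  have h0 : w ≠ 0 := by
    rintro rfl
    norm_num at hw
  have h1 := norm_evenGammaFactor_of_re_eq_half hw
  have h2 : (π : ℂ) * (w + 1) / 2 = π * w / 2 + π / 2 := by ring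
  have h3 : ((2 : ℝ) * π) ^ (-(w + 1)).re = (2 * π) ^ (-w).re * (2 * π)⁻¹ := by
    rw [← Real.rpow_neg_one, ← Real.rpow_add Real.two_pi_pos]
    congr 1
    simp
    ring
  rw [evenGammaFactor, norm_mul, norm_mul, norm_mul, norm_two_pi_cpow] at h1 ⊢
  rw [h2, Complex.cos_add_pi_div_two, norm_neg, norm_sin_half_eq_norm_cos_half hw, h3,
    Complex.Gamma_add_one _ h0, norm_mul w]
  linear_combination ‖w‖ * (2 * π)⁻¹ * h1

/-- Stirling-type bound for the factor of the functional equation. -/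
lemma exists_norm_evenGammaFactor_le : ∃ C : ℝ, 0 ≤ C ∧ ∀ w : ℂ, 1 / 2 ≤ w.re → w.re ≤ 3 / 2 →
    ‖evenGammaFactor w‖ ≤ C * (1 + |w.im|) ^ (w.re - 1 / 2) := by
  obtain ⟨D, hD, hGamma⟩ := exists_norm_Gamma_le (l := 1 / 2) (u := 3 / 2)
    (by norm_num) (by norm_num)
  refine ⟨Real.exp ((3 / 2 - 1 / 2) ^ 2 + 0 ^ 2 + 1 ^ 2) * 1, by positivity, fun w h1 h2 ↦ ?_⟩
  have h := norm_le_of_polynomial_growth_on_lines (f := evenGammaFactor) (l := 1 / 2)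
    (u := 3 / 2) (α := 0) (β := 1) (M := 1) (A := 2 * D) (B := 2) (by norm_num) le_rfl
    zero_le_one zero_le_one zero_le_two ?_ ?_ ?_ ?_ h1 h2
  · have he : (1 - (w.re - 1 / 2) / (3 / 2 - 1 / 2)) * 0 +
        (w.re - 1 / 2) / (3 / 2 - 1 / 2) * 1 = w.re - 1 / 2 := by ring
    rwa [he] at h
  · apply DifferentiableOn.diffContOnCl
    intro z hz
    have hz' : 1 / 2 ≤ z.re := by
      have hsub : closure (HadamardThreeLines.verticalStrip (1 / 2) (3 / 2)) ⊆
          {z : ℂ | 1 / 2 ≤ z.re} :=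
        closure_minimal (fun z hz ↦ hz.1.le) (isClosed_le continuous_const continuous_re)
      exact hsub hz
    have hG : DifferentiableAt ℂ Complex.Gamma z := by
      refine Complex.differentiableAt_Gamma z fun m hm ↦ ?_
      have hre := congrArg Complex.re hm
      rw [Complex.neg_re, Complex.natCast_re] at hre
      linarith [(Nat.cast_nonneg m : (0 : ℝ) ≤ m)]
    have hpi : (2 * π : ℂ) ≠ 0 := by simp [Real.pi_ne_zero]
    have hp : DifferentiableAt ℂ (fun w : ℂ ↦ (2 * π : ℂ) ^ (-w)) z :=
      differentiableAt_id.neg.const_cpow (.inl hpi)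
    have hc : DifferentiableAt ℂ (fun w : ℂ ↦ Complex.cos (π * w / 2)) z := by fun_prop
    exact (((hp.const_mul 2).mul hG).mul hc).differentiableWithinAt
  · intro z hz1 hz2
    rw [evenGammaFactor, norm_mul, norm_mul, norm_mul, norm_two_pi_cpow, Complex.norm_ofNat]
    have h3 : ((2 : ℝ) * π) ^ (-z).re ≤ 1 :=
      Real.rpow_le_one_of_one_le_of_nonpos (by linarith [Real.pi_gt_three])
        (by simp; linarith)
    have h4 : ‖Complex.cos (π * z / 2)‖ ≤ Real.exp (2 * |z.im|) := by
      refine (norm_cos_le_exp_abs_im _).trans (Real.exp_le_exp.2 ?_)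
      have : (π * z / 2 : ℂ).im = π / 2 * z.im := by simp; ring
      rw [this, abs_mul, abs_of_pos (by positivity)]
      gcongr
      linarith [Real.pi_lt_four]
    have h5 := hGamma z hz1 hz2
    calc _ ≤ 2 * 1 * D * Real.exp (2 * |z.im|) := by gcongr
      _ = _ := by ring
  · intro z hz
    simp [norm_evenGammaFactor_of_re_eq_half hz]
  · intro z hz
    have hz' : (z - 1).re = 1 / 2 := by simp [hz]; norm_num
    have := norm_evenGammaFactor_add_one hz'
    rw [sub_add_cancel] at this
    rw [this, Real.rpow_one, one_mul, div_le_iff₀ Real.two_pi_pos]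
    have h6 := Complex.norm_le_abs_re_add_abs_im (z - 1)
    rw [hz'] at h6
    norm_num at h6
    nlinarith [Real.pi_gt_three, abs_nonneg z.im]

lemma coe_unitAddCircle_ne_zero {a : ℝ} (h0 : 0 < a) (h1 : a < 1) : (a : UnitAddCircle) ≠ 0 := by
  rw [Ne, AddCircle.coe_eq_zero_iff]
  rintro ⟨n, hn⟩
  rw [zsmul_one] at hn
  rw [← hn] at h0 h1
  have h0' : 0 < n := by exact_mod_cast h0
  have h1' : n < 1 := by exact_mod_cast h1
  omega

lemma coe_fract_unitAddCircle (x : ℝ) : ((Int.fract x : ℝ) : UnitAddCircle) = x := by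
  rw [← sub_eq_zero, ← AddCircle.coe_sub, AddCircle.coe_eq_zero_iff]
  exact ⟨-⌊x⌋, by rw [zsmul_one, Int.fract]; push_cast; ring⟩

/-- Twice the even Hurwitz zeta function, without its two largest terms. -/
noncomputable def hurwitzTail (a : ℝ) (w : ℂ) : ℂ :=
  2 * hurwitzZetaEven a w - ((a : ℂ) ^ (-w) + ((1 - a : ℝ) : ℂ) ^ (-w))

/-- The entire function extending `(w - 1) * hurwitzTail a w`. -/
noncomputable def regularizedTail (a : ℝ) (w : ℂ) : ℂ :=
  2 * ((w - 1) * completedHurwitzZetaEven₀ a w + 1) * (Gammaℝ w)⁻¹ -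
    (w - 1) * ((a : ℂ) ^ (-w) + ((1 - a : ℝ) : ℂ) ^ (-w))

lemma regularizedTail_eq {a : ℝ} (h0 : 0 < a) (h1 : a < 1) {w : ℂ} (hw : w ≠ 1) :
    regularizedTail a w = (w - 1) * hurwitzTail a w := by
  have ha := coe_unitAddCircle_ne_zero h0 h1
  have hw' : 1 - w ≠ 0 := sub_ne_zero.2 hw.symm
  have hΛ : (w - 1) * completedHurwitzZetaEven a w =
      (w - 1) * completedHurwitzZetaEven₀ a w + 1 := by
    rw [completedHurwitzZetaEven_eq, if_neg ha]
    field_simp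
    ring
  rw [regularizedTail, hurwitzTail, hurwitzZetaEven_def_of_ne_or_ne (.inl ha), ← hΛ]
  ring

lemma differentiable_regularizedTail {a : ℝ} (h0 : 0 < a) (h1 : a < 1) :
    Differentiable ℂ (regularizedTail a) := by
  have hp {b : ℝ} (hb : 0 < b) : Differentiable ℂ (fun w : ℂ ↦ (b : ℂ) ^ (-w)) := fun w ↦
    differentiableAt_id.neg.const_cpow (.inl (by exact_mod_cast hb.ne'))
  have hid : Differentiable ℂ (fun w : ℂ ↦ w - 1) := by fun_prop
  exact ((((hid.mul (differentiable_completedHurwitzZetaEven₀ a)).add_const 1).const_mul 2).mul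
    differentiable_Gammaℝ_inv).sub (hid.mul ((hp h0).add (hp (sub_pos.2 h1))))

lemma norm_sub_one_le {w : ℂ} (h1 : -1 ≤ w.re) (h2 : w.re ≤ 3) :
    ‖w - 1‖ ≤ 2 * (1 + |w.im|) := by
  have h := Complex.norm_le_abs_re_add_abs_im (w - 1)
  have h3 : |(w - 1).re| ≤ 2 := by
    rw [abs_le]
    constructor <;> simp <;> linarith
  have h4 : (w - 1).im = w.im := by simp
  rw [h4] at h
  linarith [abs_nonneg w.im]

lemma exists_norm_regularizedTail_le {a : ℝ} (h0 : 0 < a) (h1 : a < 1) {l u : ℝ} (hl : -1 ≤ l)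
    (hl' : l < 2) (hu : u < 2) :
    ∃ A : ℝ, ∀ w : ℂ, l ≤ w.re → w.re ≤ u →
      ‖regularizedTail a w‖ ≤ A * Real.exp (3 * |w.im|) := by
  obtain ⟨C, hC, hΛ⟩ := exists_norm_completedHurwitzZetaEven₀_le a l u
  obtain ⟨D, hD, hΓ⟩ := exists_norm_inv_Gammaℝ_le hl' hu
  refine ⟨2 * (2 * C + 1) * D + 2 * (a ^ (-2 : ℝ) + (1 - a) ^ (-2 : ℝ)), fun w hw1 hw2 ↦ ?_⟩
  set E := Real.exp |w.im| with hE
  have hE1 : 1 ≤ E := Real.one_le_exp (abs_nonneg _)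
  have hsub : ‖w - 1‖ ≤ 2 * E := by
    refine (norm_sub_one_le (by linarith) (by linarith)).trans ?_
    have := Real.add_one_le_exp |w.im|
    linarith
  have hpow {b : ℝ} (hb0 : 0 < b) (hb1 : b < 1) : ‖(b : ℂ) ^ (-w)‖ ≤ b ^ (-2 : ℝ) := by
    rw [norm_cpow_eq_rpow_re_of_pos hb0]
    exact Real.rpow_le_rpow_of_exponent_ge hb0 hb1.le (by simp; linarith)
  have h3 : Real.exp (3 * |w.im|) = E ^ 3 := by rw [hE, ← Real.exp_nat_mul]; simp
  have h2 : Real.exp (2 * |w.im|) = E ^ 2 := by rw [hE, ← Real.exp_nat_mul]; simp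
  have hA : ‖(w - 1) * completedHurwitzZetaEven₀ a w + 1‖ ≤ (2 * C + 1) * E := by
    calc _ ≤ ‖w - 1‖ * ‖completedHurwitzZetaEven₀ a w‖ + 1 := by
          simpa using norm_add_le ((w - 1) * completedHurwitzZetaEven₀ a w) 1
      _ ≤ 2 * E * C + E := by
          gcongr
          exact hΛ w hw1 hw2
      _ = _ := by ring
  have hB : ‖(a : ℂ) ^ (-w) + ((1 - a : ℝ) : ℂ) ^ (-w)‖ ≤ a ^ (-2 : ℝ) + (1 - a) ^ (-2 : ℝ) :=
    (norm_add_le _ _).trans (add_le_add (hpow h0 h1) (hpow (by linarith) (by linarith)))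
  have hP : 0 ≤ a ^ (-2 : ℝ) + (1 - a) ^ (-2 : ℝ) := (norm_nonneg _).trans hB
  have hΓw := hΓ w hw1 hw2
  rw [h2] at hΓw
  rw [h3, regularizedTail]
  calc _ ≤ 2 * ((2 * C + 1) * E) * (D * E ^ 2) +
        2 * E * (a ^ (-2 : ℝ) + (1 - a) ^ (-2 : ℝ)) := by
        refine (norm_sub_le _ _).trans ?_
        rw [norm_mul, norm_mul, norm_mul, Complex.norm_ofNat]
        gcongr
    _ ≤ 2 * ((2 * C + 1) * E) * (D * E ^ 2) +
        2 * E ^ 3 * (a ^ (-2 : ℝ) + (1 - a) ^ (-2 : ℝ)) := by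
        gcongr
        exact le_self_pow₀ hE1 (by norm_num)
    _ = _ := by ring

lemma norm_one_div_cpow_le {b c : ℝ} (hb : 0 < b) (hbc : b ≤ c) {w : ℂ} (hw : 0 ≤ w.re) :
    ‖1 / (c : ℂ) ^ w‖ ≤ 1 / b ^ w.re := by
  rw [norm_div, norm_one, norm_cpow_eq_rpow_re_of_pos (hb.trans_le hbc)]
  gcongr

lemma norm_hurwitzTail_le {a : ℝ} (h0 : 0 < a) (h1 : a < 1) {w : ℂ} (hw : 1 < w.re) :
    ‖hurwitzTail a w‖ ≤ 2 * ∑' n : ℕ, 1 / ((n : ℝ) + 1) ^ w.re := by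
  have hs := (hasSum_nat_add_iff' 1).2
    (hasSum_nat_hurwitzZetaEven_of_mem_Icc (a := a) ⟨h0.le, h1.le⟩ hw)
  have hsum : Summable fun n : ℕ ↦ 1 / ((n : ℝ) + 1) ^ w.re := by
    simpa using (summable_nat_add_iff 1).2 (Real.summable_one_div_nat_rpow.2 hw)
  have hb := hs.norm_le_of_bounded hsum.hasSum fun n ↦ ?_
  · have he : hurwitzTail a w = 2 * (hurwitzZetaEven a w - ∑ i ∈ Finset.range 1,
        (1 / ((i : ℂ) + a) ^ w + 1 / ((i : ℂ) + 1 - a) ^ w) / 2) := by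
      simp [hurwitzTail, Complex.cpow_neg]
      ring
    rw [he, norm_mul, Complex.norm_ofNat]
    gcongr
  · have hn : (0 : ℝ) < n + 1 := by positivity
    have e1 := norm_one_div_cpow_le (c := n + 1 + a) hn (by linarith) (w := w) (by linarith)
    have e2 := norm_one_div_cpow_le (c := n + 1 + 1 - a) hn (by linarith) (w := w) (by linarith)
    push_cast at e1 e2 ⊢
    rw [norm_div, Complex.norm_ofNat, div_le_iff₀ two_pos]
    exact (norm_add_le _ _).trans (by linarith)

lemma norm_cosZeta_le (a : ℝ) {s : ℂ} (hs : 1 < s.re) :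
    ‖cosZeta a s‖ ≤ ∑' n : ℕ, 1 / (n : ℝ) ^ s.re := by
  refine (hasSum_nat_cosZeta a hs).norm_le_of_bounded
    (Real.summable_one_div_nat_rpow.2 hs).hasSum fun n ↦ ?_
  rcases n.eq_zero_or_pos with rfl | hn
  · simp [Complex.zero_cpow (Complex.ne_zero_of_one_lt_re hs),
      Real.zero_rpow (by linarith : s.re ≠ 0)]
  · rw [norm_div, Complex.norm_natCast_cpow_of_pos hn, Complex.norm_real]
    gcongr
    exact Real.abs_cos_le_one _

lemma hurwitzZetaEven_eq_evenGammaFactor_mul {a : ℝ} (h0 : 0 < a) (h1 : a < 1) {w : ℂ}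
    (hw : w.re < 1) :
    hurwitzZetaEven a w = evenGammaFactor (1 - w) * cosZeta a (1 - w) := by
  have h := hurwitzZetaEven_one_sub a (s := 1 - w) (fun n hn ↦ ?_)
    (.inl (coe_unitAddCircle_ne_zero h0 h1))
  · rwa [sub_sub_cancel] at h
  · have hre := congrArg Complex.re hn
    simp at hre
    linarith [n.cast_nonneg (α := ℝ)]

lemma Kplus_one_sub_eq_mul_hurwitzTail {x : ℝ} (hx : Int.fract x ≠ 0) {w : ℂ}
    (hw : w.re = 1 / 2) :
    Kplus (1 - w) x = evenGammaFactor w * hurwitzTail (Int.fract x) w := by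
  have h := cosZeta_one_sub (x : UnitAddCircle) (s := w) (fun n hn ↦ ?_)
  · rw [Kplus, Fplus, chiFE_one_sub, show 1 - w - 1 = -w by ring, hurwitzTail,
      coe_fract_unitAddCircle, Int.fract_neg hx, AddCircle.coe_neg]
    have h2 := cosZeta_eq (x : UnitAddCircle) (1 - w)
    rw [h, ← evenGammaFactor] at h2
    linear_combination -2 * h2
  · have hre := congrArg Complex.re hn
    simp [hw] at hre
    have : (2 * n : ℝ) = 1 := by linarith
    have : 2 * n = 1 := by exact_mod_cast this
    omega

/-- Convexity bound for the regularized tail, uniform in the shift. -/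
lemma exists_norm_regularizedTail_half_le {δ : ℝ} (hδ : 0 < δ) (hδ' : δ ≤ 1 / 4) :
    ∃ C : ℝ, 0 ≤ C ∧ ∀ a : ℝ, 0 < a → a < 1 → ∀ w : ℂ, w.re = 1 / 2 →
      ‖regularizedTail a w‖ ≤ C * (1 + |w.im|) ^ (5 / 4 + δ / 2) := by
  obtain ⟨Cγ, hCγ, hγ⟩ := exists_norm_evenGammaFactor_le
  set S := ∑' n : ℕ, 1 / (n : ℝ) ^ (1 + δ)
  set S' := ∑' n : ℕ, 1 / ((n : ℝ) + 1) ^ (1 + δ)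
  have hS0 : 0 ≤ S := tsum_nonneg fun n ↦ by positivity
  have hS0' : 0 ≤ S' := tsum_nonneg fun n ↦ by positivity
  set M := 4 * (Cγ * S + 1) + 4 * S'
  have hM0 : 0 ≤ M := by positivity
  refine ⟨Real.exp ((1 + δ - -δ) ^ 2 + (3 / 2 + δ) ^ 2 + 1 ^ 2) * M, by positivity,
    fun a h0 h1 w hw ↦ ?_⟩
  obtain ⟨A, hA⟩ := exists_norm_regularizedTail_le h0 h1 (l := -δ) (u := 1 + δ) (by linarith)
    (by linarith) (by linarith)
  have h := norm_le_of_polynomial_growth_on_lines (f := regularizedTail a) (l := -δ) (u := 1 + δ)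
    (α := 3 / 2 + δ) (β := 1) (M := M) (A := A) (B := 3) (by linarith) (by linarith) zero_le_one hM0
    (by norm_num) (differentiable_regularizedTail h0 h1).diffContOnCl hA ?_ ?_ (w₀ := w)
    (by linarith) (by linarith)
  · have hθ : (w.re - -δ) / (1 + δ - -δ) = 1 / 2 := by
      rw [hw, div_eq_iff (by linarith)]
      ring
    rw [hθ, show (1 - 1 / 2) * (3 / 2 + δ) + 1 / 2 * 1 = 5 / 4 + δ / 2 by ring] at h
    exact h
  · intro z hz
    have hz1 : z ≠ 1 := by
      rintro rfl
      simp at hz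
      linarith
    have hp : 1 ≤ 1 + |z.im| := by linarith [abs_nonneg z.im]
    have hre : (1 - z).re = 1 + δ := by simp [hz]
    have him : |(1 - z).im| = |z.im| := by simp
    have hH : ‖hurwitzZetaEven a z‖ ≤ Cγ * (1 + |z.im|) ^ (1 / 2 + δ) * S := by
      rw [hurwitzZetaEven_eq_evenGammaFactor_mul h0 h1 (by linarith), norm_mul]
      have g1 := hγ (1 - z) (by linarith) (by linarith)
      have g2 := norm_cosZeta_le a (s := 1 - z) (by linarith)
      rw [hre, him, show 1 + δ - 1 / 2 = 1 / 2 + δ by ring] at g1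
      rw [hre] at g2
      gcongr
    have hpow {b : ℝ} (hb0 : 0 < b) (hb1 : b < 1) : ‖(b : ℂ) ^ (-z)‖ ≤ 1 := by
      rw [norm_cpow_eq_rpow_re_of_pos hb0]
      exact Real.rpow_le_one hb0.le hb1.le (by simp [hz]; linarith)
    have hT : ‖hurwitzTail a z‖ ≤ 2 * (Cγ * S + 1) * (1 + |z.im|) ^ (1 / 2 + δ) := by
      have h2 := Real.one_le_rpow hp (by linarith : 0 ≤ 1 / 2 + δ)
      calc _ ≤ 2 * ‖hurwitzZetaEven a z‖ + (‖(a : ℂ) ^ (-z)‖ + ‖((1 - a : ℝ) : ℂ) ^ (-z)‖) := by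
            refine (norm_sub_le _ _).trans ?_
            rw [norm_mul, Complex.norm_ofNat]
            gcongr
            exact norm_add_le _ _
        _ ≤ 2 * (Cγ * (1 + |z.im|) ^ (1 / 2 + δ) * S) + (1 + 1) := by
            gcongr
            · exact hpow h0 h1
            · exact hpow (by linarith) (by linarith)
        _ ≤ _ := by linarith
    rw [regularizedTail_eq h0 h1 hz1, norm_mul,
      show 3 / 2 + δ = 1 + (1 / 2 + δ) by ring, Real.rpow_add (by linarith), Real.rpow_one]
    calc _ ≤ 2 * (1 + |z.im|) * (2 * (Cγ * S + 1) * (1 + |z.im|) ^ (1 / 2 + δ)) := by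
          gcongr
          exact norm_sub_one_le (by linarith) (by linarith)
      _ = 4 * (Cγ * S + 1) * ((1 + |z.im|) * (1 + |z.im|) ^ (1 / 2 + δ)) := by ring
      _ ≤ _ := by
          gcongr
          linarith
  · intro z hz
    have hz1 : z ≠ 1 := by
      rintro rfl
      simp at hz
      linarith
    have hT := norm_hurwitzTail_le h0 h1 (w := z) (by linarith)
    rw [hz] at hT
    rw [regularizedTail_eq h0 h1 hz1, norm_mul, Real.rpow_one]
    calc _ ≤ 2 * (1 + |z.im|) * (2 * S') := by
          gcongr
          exact norm_sub_one_le (by linarith) (by linarith)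
      _ = 4 * S' * (1 + |z.im|) := by ring
      _ ≤ _ := by
          gcongr
          have : 0 ≤ Cγ * S := by positivity
          linarith

/-- Uniform convexity bound: for every `ε > 0` there is `C_ε > 0` such that for all
`x ∉ ℤ` and all real `t`, `|K⁺(1/2 + it, x)| ≤ C_ε (1 + |t|)^{1/4 + ε}`. -/
theorem Kplus_convexity_bound (ε : ℝ) (hε : 0 < ε) :
    ∃ C : ℝ, 0 < C ∧ ∀ x : ℝ, Int.fract x ≠ 0 → ∀ t : ℝ,
      ‖Kplus (1 / 2 + t * Complex.I) x‖ ≤ C * (1 + |t|) ^ ((1 : ℝ) / 4 + ε) := by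
  set δ := min ε (1 / 4)
  have hδ0 : 0 < δ := lt_min hε (by norm_num)
  obtain ⟨C, hC, h⟩ := exists_norm_regularizedTail_half_le hδ0 (min_le_right _ _)
  refine ⟨3 * C + 1, by positivity, fun x hx t ↦ ?_⟩
  set a := Int.fract x
  have h0 : 0 < a := lt_of_le_of_ne (Int.fract_nonneg x) hx.symm
  have h1 : a < 1 := Int.fract_lt_one x
  set w : ℂ := 1 / 2 - t * Complex.I with hw
  have hre : w.re = 1 / 2 := by simp [hw]
  have him : |w.im| = |t| := by simp [hw]
  have hne : w ≠ 1 := by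
    intro h
    rw [h] at hre
    norm_num at hre
  have hp : 0 < 1 + |t| := by positivity
  have hlow : (1 + |t|) / 3 ≤ ‖w - 1‖ := by
    have e1 := Complex.abs_re_le_norm (w - 1)
    have e2 := Complex.abs_im_le_norm (w - 1)
    have e3 : (w - 1).re = -(1 / 2) := by rw [sub_re, hre, one_re]; norm_num
    have e4 : (w - 1).im = w.im := by simp
    rw [e3, abs_neg, abs_of_pos (by norm_num)] at e1
    rw [e4, him] at e2
    linarith
  have hK : ‖Kplus (1 / 2 + t * Complex.I) x‖ = ‖hurwitzTail a w‖ := by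
    rw [show (1 / 2 + t * Complex.I : ℂ) = 1 - w by rw [hw]; ring,
      Kplus_one_sub_eq_mul_hurwitzTail hx hre, norm_mul,
      norm_evenGammaFactor_of_re_eq_half hre, one_mul]
  have hG := h a h0 h1 w hre
  rw [regularizedTail_eq h0 h1 hne, norm_mul, him,
    show 5 / 4 + δ / 2 = 1 + (1 / 4 + δ / 2) by ring, Real.rpow_add hp, Real.rpow_one] at hG
  have hT : ‖hurwitzTail a w‖ ≤ 3 * C * (1 + |t|) ^ (1 / 4 + δ / 2) := by
    have e5 := mul_le_mul_of_nonneg_right hlow (norm_nonneg (hurwitzTail a w))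
    refine le_of_mul_le_mul_left ?_ hp
    linarith
  rw [hK]
  refine hT.trans ?_
  have hδε : δ ≤ ε := min_le_left _ _
  gcongr
  · linarith
  · linarith [abs_nonneg t]
  · linarith
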